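/- (Parametric family of optimal three-party probes) Let 0 < α < 1 and let χ be a real number with α/2 ≤ sin²χ ≤ (1+α)/4. Let ψ be any 3-qubit pure state whose amplitudes have squared moduli depending only on the number of 1's in x as follows: |ψ(x)|² = sin²χ if x = (0,0,0); |ψ(x)|² = (1+α)/4 − sin²χ if exactly one coordinate of x equals 1; |ψ(x)|² = sin²χ − α/2 if exactly two coordinates of x equal 1; and |ψ(x)|² = (1+3α)/4 − sin²χ if x = (1,1,1) (the relative phases of the amplitudes being arbitrary). Then ψ is a unit vector, E_ψ[Z_i] = 0 for all i ∈ {1,2,3}, and E_ψ[Z_i Z_j] = α for all i ≠ j; hence every such state attains the optimal precision Tr(W̄·F⁻¹) = 4N for N = 3. -/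

import Mathlib

open scoped BigOperators

/-- Sign of a qubit basis label: `ε(0) = 1`, `ε(1) = −1`. -/
def qubitSign : Fin 2 → ℝ := fun b => if b = 0 then 1 else -1

/-- Pauli-z expectation `E_ψ[Z_i] = Σ_x ε(x i) |ψ x|²` of an `N`-qubit state. -/
noncomputable def expZ {N : ℕ} (ψ : (Fin N → Fin 2) → ℂ) (i : Fin N) : ℝ :=
  ∑ x : Fin N → Fin 2, qubitSign (x i) * ‖ψ x‖ ^ 2

/-- Pauli-z correlator `E_ψ[Z_i Z_j] = Σ_x ε(x i) ε(x j) |ψ x|²`. -/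
noncomputable def expZZ {N : ℕ} (ψ : (Fin N → Fin 2) → ℂ) (i j : Fin N) : ℝ :=
  ∑ x : Fin N → Fin 2, qubitSign (x i) * qubitSign (x j) * ‖ψ x‖ ^ 2

/-- Quantum Fisher information matrix of the pure probe `ψ` for estimating the `N`
independent field strengths of the Hamiltonian `H = ħ Σ_i h_i σ_z^i`:
`F_ii = 4(1 − E_ψ[Z_i]²)` and `F_ij = 4(E_ψ[Z_i Z_j] − E_ψ[Z_i] E_ψ[Z_j])` for `i ≠ j`. -/
noncomputable def qfim {N : ℕ} (ψ : (Fin N → Fin 2) → ℂ) : Matrix (Fin N) (Fin N) ℝ :=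
  Matrix.of fun i j =>
    if i = j then 4 * (1 - expZ ψ i ^ 2)
    else 4 * (expZZ ψ i j - expZ ψ i * expZ ψ j)

/-- The weight matrix `W̄ = a·I + b·(J − I)` with `a = 16[(N−1)α² + 1]`,
`b = 16[(N−2)α² + 2α]`, `J` the all-ones matrix. -/
noncomputable def weightW (N : ℕ) (α : ℝ) : Matrix (Fin N) (Fin N) ℝ :=
  (16 * (((N : ℝ) - 1) * α ^ 2 + 1)) • (1 : Matrix (Fin N) (Fin N) ℝ)
    + (16 * (((N : ℝ) - 2) * α ^ 2 + 2 * α)) •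
        ((Matrix.of fun _ _ => (1 : ℝ)) - (1 : Matrix (Fin N) (Fin N) ℝ))

/-- A sum over three-qubit basis labels, written out over the three coordinates. -/
theorem sum_three_qubit_labels {M : Type*} [AddCommMonoid M] (f : (Fin 3 → Fin 2) → M) :
    ∑ x, f x = ∑ a, ∑ b, ∑ c, f ![a, b, c] := by
  let e : Fin 2 × Fin 2 × Fin 2 ≃ (Fin 3 → Fin 2) :=
    { toFun := fun p => ![p.1, p.2.1, p.2.2]
      invFun := fun x => (x 0, x 1, x 2)
      left_inv := fun _ => rfl
      right_inv := fun x => by ext i; fin_cases i <;> rfl }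
  rw [← e.sum_comp f]
  simp only [Fintype.sum_prod_type]
  rfl

/-- Parametric family of optimal three-party probes: any 3-qubit pure state whose
squared amplitude moduli depend only on the number of 1's in the basis label as
`sin²χ`, `(1+α)/4 − sin²χ`, `sin²χ − α/2`, `(1+3α)/4 − sin²χ` for `0, 1, 2, 3`
ones respectively (with arbitrary relative phases), where `α/2 ≤ sin²χ ≤ (1+α)/4`,
is a unit vector with `E_ψ[Z_i] = 0` and `E_ψ[Z_i Z_j] = α` for `i ≠ j`; hence it
attains the optimal precision `Tr(W̄ F⁻¹) = 4N` for `N = 3`. -/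
theorem three_party_optimal_probe_family
    (α : ℝ) (hα0 : 0 < α) (hα1 : α < 1) (χ : ℝ)
    (hlo : α / 2 ≤ Real.sin χ ^ 2) (hhi : Real.sin χ ^ 2 ≤ (1 + α) / 4)
    (ψ : (Fin 3 → Fin 2) → ℂ)
    (hmod : ∀ x : Fin 3 → Fin 2,
      ‖ψ x‖ ^ 2 =
        if (Finset.univ.filter fun i => x i = 1).card = 0 then Real.sin χ ^ 2
        else if (Finset.univ.filter fun i => x i = 1).card = 1 then
          (1 + α) / 4 - Real.sin χ ^ 2
        else if (Finset.univ.filter fun i => x i = 1).card = 2 then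
          Real.sin χ ^ 2 - α / 2
        else (1 + 3 * α) / 4 - Real.sin χ ^ 2) :
    (∑ x : Fin 3 → Fin 2, ‖ψ x‖ ^ 2 = 1) ∧
    (∀ i, expZ ψ i = 0) ∧
    (∀ i j, i ≠ j → expZZ ψ i j = α) := by
  have hcard : ∀ a b c : Fin 2, (Finset.univ.filter fun i => ![a, b, c] i = 1).card =
      a.val + b.val + c.val := by decide
  refine ⟨?_, fun i => ?_, fun i j hij => ?_⟩
  · simp only [sum_three_qubit_labels, hmod, hcard, Fin.sum_univ_two]
    norm_num
    ring
  · simp only [expZ, sum_three_qubit_labels, hmod, hcard, Fin.sum_univ_two]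
    fin_cases i <;> norm_num [qubitSign] <;> ring
  · simp only [expZZ, sum_three_qubit_labels, hmod, hcard, Fin.sum_univ_two]
    fin_cases i <;> fin_cases j <;> first | exact absurd rfl hij | (norm_num [qubitSign]; ring)
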